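/- Let n ≥ 1, let m < 2^n be a mask with popcount d, let a ≤ b be patterns for m, and let r be the cardinality of {q : q &&& m = q ∧ a ≤ q ≤ b}. Then every x < 2^n with a ≤ x &&& m ≤ b satisfies a ≤ x ≤ b + (2^n − 1 − m); both a and b + (2^n − 1 − m) belong to the range-PSP locus; and the number of integers x with a ≤ x ≤ b + (2^n − 1 − m) and not (a ≤ x &&& m ≤ b) equals (b − a + 2^n − m) − r·2^{n−d}. (Spread and total lacunae length of the range PSP, Proposition 5.) -/

import Mathlib

theorem Nat.add_eq_lor_of_land_eq_zero {x y : ℕ} (h : x &&& y = 0) : x + y = x ||| y := by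
  induction x using Nat.strong_induction_on generalizing y with
  | _ x ih =>
    rcases Nat.eq_zero_or_pos x with rfl | hx
    · simp
    have hdiv : x / 2 &&& y / 2 = 0 := by rw [← Nat.and_div_two, h]
    have hsum := ih (x / 2) (by omega) hdiv
    rw [← Nat.or_div_two] at hsum
    have hand : ¬(x % 2 = 1 ∧ y % 2 = 1) := by
      rw [← Nat.and_mod_two_eq_one, h]
      decide
    have hor := Nat.or_mod_two_eq_one (a := x) (b := y)
    omega

theorem Nat.testBit_two_pow_sub_one_sub {n m : ℕ} (hm : m < 2 ^ n) (i : ℕ) :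
    (2 ^ n - 1 - m).testBit i = (decide (i < n) && !m.testBit i) := by
  rw [Nat.sub_sub, Nat.add_comm 1 m, Nat.testBit_two_pow_sub_succ hm]

theorem Nat.land_add_land_two_pow_sub_one_sub {n m x : ℕ} (hm : m < 2 ^ n) (hx : x < 2 ^ n) :
    (x &&& m) + (x &&& (2 ^ n - 1 - m)) = x := by
  rw [Nat.add_eq_lor_of_land_eq_zero]
  · refine Nat.eq_of_testBit_eq fun i => ?_
    rw [Nat.testBit_or, Nat.testBit_and, Nat.testBit_and, Nat.testBit_two_pow_sub_one_sub hm]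
    by_cases hi : i < n
    · cases x.testBit i <;> cases m.testBit i <;> simp [hi]
    · simp [Nat.testBit_eq_false_of_lt
        (hx.trans_le (Nat.pow_le_pow_right two_pos (not_lt.mp hi)))]
  · refine Nat.eq_of_testBit_eq fun i => ?_
    simp only [Nat.testBit_and, Nat.testBit_two_pow_sub_one_sub hm, Nat.zero_testBit]
    cases m.testBit i <;> simp

theorem Nat.add_two_pow_sub_one_sub_land {n m b : ℕ} (hm : m < 2 ^ n) (hb : b &&& m = b) :
    (b + (2 ^ n - 1 - m)) &&& m = b := by
  have hcompl (i : ℕ) : ¬(m.testBit i = true ∧ (2 ^ n - 1 - m).testBit i = true) := by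
    rw [Nat.testBit_two_pow_sub_one_sub hm]
    cases m.testBit i <;> simp
  have hzero : m &&& (2 ^ n - 1 - m) = 0 := by
    refine Nat.eq_of_testBit_eq fun i => ?_
    have := hcompl i
    rw [Nat.testBit_and, Nat.zero_testBit]
    simpa using this
  have hdisj : b &&& (2 ^ n - 1 - m) = 0 := by rw [← hb, Nat.and_assoc, hzero, Nat.and_zero]
  rw [Nat.add_eq_lor_of_land_eq_zero hdisj, Nat.and_or_distrib_right, hb,
    Nat.and_comm (2 ^ n - 1 - m), hzero, Nat.or_zero]

/-- Keys below `2 ^ n` with a prescribed pattern `q` on the mask `m` are freely determined by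
the unmasked bits. -/
theorem Nat.card_filter_land_eq {n m q : ℕ} (hm : m < 2 ^ n) (hq : q &&& m = q) :
    ((Finset.range (2 ^ n)).filter fun x => x &&& m = q).card =
      2 ^ (n - ((Finset.range n).filter fun i => m.testBit i).card) := by
  have hfree : ((Finset.range n).filter fun i => ¬m.testBit i).card =
      n - ((Finset.range n).filter fun i => m.testBit i).card := by
    have := Finset.card_filter_add_card_filter_not (s := Finset.range n)
      (fun i => m.testBit i = true)
    rw [Finset.card_range] at this
    omega
  rw [← hfree, ← Finset.card_powerset]
  refine Finset.card_bij
    (fun x _ => ((Finset.range n).filter fun i => ¬m.testBit i).filter fun i => x.testBit i)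
    (fun x _ => Finset.mem_powerset.mpr (Finset.filter_subset _ _)) ?_ ?_
  · intro x hx y hy hxy
    simp only [Finset.mem_filter, Finset.mem_range] at hx hy
    refine Nat.eq_of_testBit_eq fun i => ?_
    by_cases hi : i < n
    · by_cases hmi : m.testBit i
      · have := congrArg (·.testBit i) (hx.2.trans hy.2.symm)
        simpa [hmi] using this
      · have := congrArg (i ∈ ·) hxy
        simpa [hmi, hi, ← Bool.eq_iff_iff] using this
    · have hpow := Nat.pow_le_pow_right two_pos (not_lt.mp hi)
      rw [Nat.testBit_eq_false_of_lt (hx.1.trans_le hpow),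
        Nat.testBit_eq_false_of_lt (hy.1.trans_le hpow)]
  · intro s hs
    rw [Finset.mem_powerset] at hs
    have hsbit (i : ℕ) : (∑ j ∈ s, 2 ^ j).testBit i = true ↔ i ∈ s := by
      rw [← Nat.mem_bitIndices, ← List.mem_toFinset, Finset.toFinset_bitIndices_sum_two_pow]
    have hqbit (i : ℕ) (h : q.testBit i = true) : m.testBit i = true := by
      rw [← hq, Nat.testBit_and, Bool.and_eq_true] at h
      exact h.2
    have hsfree {i : ℕ} (hi : i ∈ s) : i < n ∧ ¬m.testBit i = true := by
      simpa using hs hi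
    have hslt : ∑ j ∈ s, 2 ^ j < 2 ^ n := by
      refine Nat.lt_pow_two_of_testBit _ fun i hi => ?_
      rw [← Bool.not_eq_true, hsbit]
      exact fun h => (hsfree h).1.not_ge hi
    refine ⟨q ||| ∑ j ∈ s, 2 ^ j, ?_, ?_⟩
    · rw [Finset.mem_filter, Finset.mem_range]
      refine ⟨Nat.or_lt_two_pow ((hq ▸ Nat.and_le_right).trans_lt hm) hslt, ?_⟩
      rw [Nat.and_or_distrib_right, hq]
      convert Nat.or_zero q
      refine Nat.eq_of_testBit_eq fun i => ?_
      rw [Nat.zero_testBit, Nat.testBit_and, ← Bool.not_eq_true, Bool.and_eq_true, hsbit]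
      exact fun h => (hsfree h.1).2 h.2
    · ext i
      simp only [Finset.mem_filter, Finset.mem_range, Nat.testBit_or, Bool.or_eq_true, hsbit]
      exact ⟨fun h => h.2.resolve_left fun hi => h.1.2 (hqbit i hi),
        fun h => ⟨hsfree h, Or.inr h⟩⟩


/-- Spread and total lacunae length of the range PSP (Proposition 5): the locus is
contained in `[a, b + (2^n - 1 - m)]`, both endpoints belong to the locus, and the number
of non-matching keys in this bounding interval equals the spread `b - a + 2^n - m` minus
the locus cardinality `r·2^{n-d}`. -/
theorem range_psp_bounding_and_lacunae (n m d a b r : ℕ) (hn : 1 ≤ n) (hm : m < 2 ^ n)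
    (hd : d = ((Finset.range n).filter (fun i => m.testBit i)).card)
    (ha : a &&& m = a) (hb : b &&& m = b) (hab : a ≤ b)
    (hr : r = Set.ncard {q : ℕ | q &&& m = q ∧ a ≤ q ∧ q ≤ b}) :
    (∀ x, x < 2 ^ n → a ≤ x &&& m → x &&& m ≤ b →
      a ≤ x ∧ x ≤ b + (2 ^ n - 1 - m)) ∧
    a ∈ {x : ℕ | x < 2 ^ n ∧ a ≤ x &&& m ∧ x &&& m ≤ b} ∧
    b + (2 ^ n - 1 - m) ∈ {x : ℕ | x < 2 ^ n ∧ a ≤ x &&& m ∧ x &&& m ≤ b} ∧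
    Set.ncard {x : ℕ | a ≤ x ∧ x ≤ b + (2 ^ n - 1 - m) ∧
        ¬(a ≤ x &&& m ∧ x &&& m ≤ b)} =
      (b - a + 2 ^ n - m) - r * 2 ^ (n - d) := by

  have hbm : b ≤ m := hb ▸ Nat.and_le_right
  have hbound (x : ℕ) (hx : x < 2 ^ n) (hax : a ≤ x &&& m) (hxb : x &&& m ≤ b) :
      a ≤ x ∧ x ≤ b + (2 ^ n - 1 - m) := by
    have hsplit := Nat.land_add_land_two_pow_sub_one_sub hm hx
    have hle : x &&& (2 ^ n - 1 - m) ≤ 2 ^ n - 1 - m := Nat.and_le_right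
    omega
  have htop := Nat.add_two_pow_sub_one_sub_land hm hb
  refine ⟨hbound, ⟨by omega, by rw [ha], by rwa [ha]⟩,
    ⟨by omega, by rwa [htop], by rw [htop]⟩, ?_⟩
  let I := Finset.Icc a (b + (2 ^ n - 1 - m))
  let P := (Finset.Icc a b).filter fun q => q &&& m = q
  have hP : P.card = r := by
    rw [hr, ← Set.ncard_coe_finset]
    congr 1
    ext q
    simp only [P, Finset.coe_filter, Finset.mem_Icc, Set.mem_ofPred_eq]
    tauto
  have hlocus : (I.filter fun x => a ≤ x &&& m ∧ x &&& m ≤ b).card = r * 2 ^ (n - d) := by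
    rw [Finset.card_eq_sum_card_fiberwise (f := (· &&& m)) (t := P), ← hP, hd]
    · rw [← smul_eq_mul]
      refine Finset.sum_eq_card_nsmul fun q hq => ?_
      simp only [P, Finset.mem_filter, Finset.mem_Icc] at hq
      rw [← Nat.card_filter_land_eq hm hq.2]
      congr 1
      ext x
      simp only [I, Finset.mem_filter, Finset.mem_Icc, Finset.mem_range]
      constructor
      · rintro ⟨⟨hx, -⟩, hxq⟩
        exact ⟨by omega, hxq⟩
      · rintro ⟨hx, rfl⟩
        exact ⟨⟨hbound x hx hq.1.1 hq.1.2, hq.1⟩, rfl⟩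
    · intro x hx
      simp only [P, Finset.coe_filter, Finset.mem_Icc, Set.mem_ofPred_eq] at hx ⊢
      exact ⟨hx.2, by rw [Nat.and_assoc, Nat.and_self]⟩
  have hlacunae : {x : ℕ | a ≤ x ∧ x ≤ b + (2 ^ n - 1 - m) ∧ ¬(a ≤ x &&& m ∧ x &&& m ≤ b)} =
      ↑(I.filter fun x => ¬(a ≤ x &&& m ∧ x &&& m ≤ b)) := by
    ext x
    simp only [I, Finset.coe_filter, Finset.mem_Icc, Set.mem_ofPred_eq, and_assoc]
  have hcount := Finset.card_filter_add_card_filter_not (s := I)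
    (fun x => a ≤ x &&& m ∧ x &&& m ≤ b)
  have hI : I.card = b - a + 2 ^ n - m := by
    rw [Nat.card_Icc]
    omega
  rw [hlacunae, Set.ncard_coe_finset]
  omega
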